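/- Let n ≥ 1 and l ≥ 2 be integers, and let T be a finite non-empty set of tuples (a₁,…,a_k) of integers not divisible by l, of lengths k with 0 ≤ k ≤ n, containing at least one tuple of length exactly n. Suppose that the set S = { [a₁,…,a_k]_l : (a₁,…,a_k) ∈ T } is a modular set. Then for every divisor t of l, the maximum over all tuples (a₁,…,a_k) ∈ T and all integers a coprime to t of the sum Σ_{j=1}^k B(a_j·a/t) is equal to n/(6t²). -/

import Mathlib

open Complex Filter Topology UpperHalfPlane Matrix MatrixGroups
open scoped Real Manifold

noncomputable section

/-- `B(x) = y² − y + 1/6` where `y` is the fractional part of `x`. -/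
def bern (x : ℝ) : ℝ := Int.fract x ^ 2 - Int.fract x + 1 / 6

/-- The modular unit `[r]_l`. -/
def rl (l r : ℤ) : UpperHalfPlane → ℂ := fun z =>
  Complex.exp (2 * (π : ℂ) * Complex.I *
      ((-((l : ℝ) * bern ((r : ℝ) / (l : ℝ)) / 2) : ℝ) : ℂ) * (z : ℂ)) *
    (∏' n : {n : ℤ // 0 < n ∧ n ≡ r [ZMOD l]},
      (1 - Complex.exp (2 * (π : ℂ) * Complex.I * ((n : ℤ) : ℂ) * (z : ℂ)))⁻¹) *
    (∏' n : {n : ℤ // 0 < n ∧ n ≡ -r [ZMOD l]},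
      (1 - Complex.exp (2 * (π : ℂ) * Complex.I * ((n : ℤ) : ℂ) * (z : ℂ)))⁻¹)

/-- A modular set: a finite non-empty set of functions on `ℍ` whose (complex) span is
invariant under the action of `SL(2,ℤ)`. -/
def IsModularSet (S : Set (UpperHalfPlane → ℂ)) : Prop :=
  S.Finite ∧ S.Nonempty ∧
  ∀ A : SL(2, ℤ), ∀ f ∈ Submodule.span ℂ S, (fun z => f (A • z)) ∈ Submodule.span ℂ S

/-- The product `[a₁,…,a_k]_l = ∏_j [a_j]_l` attached to a tuple (list) of integers. -/
def listProdRl (l : ℕ) (L : List ℤ) : UpperHalfPlane → ℂ :=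
  fun z => (L.map fun r => rl l r z).prod

theorem prod_exp (p Q : ℂ) (hp : ‖p‖ < 1) (hQ : ‖Q‖ < 1) :
    ∏' j : ℕ, (1 - p * Q ^ j)⁻¹ =
      Complex.exp (∑' k : ℕ, p ^ (k + 1) / (1 - Q ^ (k + 1)) / ((k : ℂ) + 1)) := by
  have hw : ∀ j : ℕ, ‖p * Q ^ j‖ < 1 := by
    intro j
    rw [norm_mul, norm_pow]
    calc ‖p‖ * ‖Q‖ ^ j ≤ ‖p‖ * 1 := by
          gcongr
          exact pow_le_one₀ (norm_nonneg _) hQ.le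
      _ < 1 := by simpa using hp
  have hlog : ∀ j : ℕ, HasSum (fun k : ℕ => (p * Q ^ j) ^ (k + 1) / ((k : ℂ) + 1))
      (Complex.log ((1 - p * Q ^ j)⁻¹)) := by
    intro j
    rw [Complex.log_inv]
    · exact Complex.hasSum_taylorSeries_neg_log' (hw j)
    · have := Complex.mem_slitPlane_of_norm_lt_one (z := -(p * Q ^ j)) (by simpa using hw j)
      rw [← sub_eq_add_neg] at this
      exact Complex.slitPlane_arg_ne_pi this
  have hsum : Summable (Function.uncurry fun (j k : ℕ) =>
      (p * Q ^ j) ^ (k + 1) / ((k : ℂ) + 1)) := by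
    have h1 : Summable (fun x : ℕ × ℕ => ‖Q‖ ^ x.1 * ‖p‖ ^ x.2) :=
      (summable_geometric_of_lt_one (norm_nonneg _) hQ).mul_of_nonneg
        (summable_geometric_of_lt_one (norm_nonneg _) hp) (fun _ => by positivity)
        (fun _ => by positivity)
    refine Summable.of_norm_bounded h1 ?_
    rintro ⟨j, k⟩
    simp only [Function.uncurry]
    rw [norm_div, norm_pow, norm_mul, norm_pow, mul_pow, ← pow_mul, mul_comm (‖Q‖ ^ j)]
    have hk : ‖(k : ℂ) + 1‖ = (k : ℝ) + 1 := by
      exact_mod_cast Complex.norm_natCast (k + 1)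
    rw [hk]
    have a1 : ‖p‖ ^ (k + 1) ≤ ‖p‖ ^ k :=
      pow_le_pow_of_le_one (norm_nonneg _) hp.le (by omega)
    have a2 : ‖Q‖ ^ (j * (k + 1)) ≤ ‖Q‖ ^ j :=
      pow_le_pow_of_le_one (norm_nonneg _) hQ.le (by nlinarith [Nat.zero_le (j * k)])
    calc ‖p‖ ^ (k + 1) * ‖Q‖ ^ (j * (k + 1)) / ((k : ℝ) + 1)
        ≤ ‖p‖ ^ (k + 1) * ‖Q‖ ^ (j * (k + 1)) :=
          div_le_self (by positivity) (by linarith [Nat.cast_nonneg (α := ℝ) k])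
      _ ≤ _ := by gcongr
  have hne : ∀ j : ℕ, (1 - p * Q ^ j)⁻¹ ≠ 0 := by
    intro j
    apply inv_ne_zero
    intro h
    have := hw j
    rw [← sub_eq_zero.mp h] at this
    simp at this
  have hs : Summable fun j : ℕ => Complex.log ((1 - p * Q ^ j)⁻¹) := by
    have := hsum.prod
    refine this.congr fun j => ?_
    exact (hlog j).tsum_eq
  rw [← Complex.cexp_tsum_eq_tprod hne hs]
  congr 1
  rw [tsum_congr (fun j => (hlog j).tsum_eq.symm), ← hsum.tsum_comm]
  refine tsum_congr fun k => ?_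
  have h2 : ‖Q ^ (k + 1)‖ < 1 := by
    rw [norm_pow]; exact pow_lt_one₀ (norm_nonneg _) hQ (by omega)
  rw [div_eq_mul_inv (p ^ (k + 1)), ← tsum_geometric_of_norm_lt_one h2, ← tsum_mul_left,
    ← tsum_div_const]
  refine tsum_congr fun j => ?_
  rw [mul_pow, ← pow_mul, ← pow_mul, mul_comm j]

/-- Parametrization of the positive integers in a residue class. -/
def clsEquiv (l r : ℤ) (hl : 0 < l) (hr : ¬ l ∣ r) :
    ℕ ≃ {n : ℤ // 0 < n ∧ n ≡ r [ZMOD l]} where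
  toFun j := ⟨r % l + l * j, by
    have h1 := Int.emod_nonneg r hl.ne'
    have h2 : r % l ≠ 0 := fun h => hr (Int.dvd_of_emod_eq_zero h)
    have h3 : 0 ≤ l * (j : ℤ) := by positivity
    omega, by simp [Int.ModEq]⟩
  invFun n := ((n : ℤ) / l).toNat
  left_inv j := by
    have h1 := Int.emod_nonneg r hl.ne'
    have h2 := Int.emod_lt_of_pos r hl
    simp only
    rw [Int.add_mul_ediv_left _ _ hl.ne', Int.ediv_eq_zero_of_lt h1 h2]
    simp
  right_inv := by
    rintro ⟨n, hn, hm⟩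
    ext
    simp only
    rw [Int.toNat_of_nonneg (Int.ediv_nonneg hn.le hl.le), ← hm]
    exact Int.emod_add_mul_ediv n l

/-- `exp (2πi s z)` -/
def ee (s : ℤ) (z : ℂ) : ℂ := Complex.exp (2 * (π : ℂ) * Complex.I * (s : ℂ) * z)

theorem ee_norm (s : ℤ) (z : ℂ) : ‖ee s z‖ = Real.exp (-(2 * π * s * z.im)) := by
  rw [ee, Complex.norm_exp]
  congr 1
  simp

theorem ee_norm_lt (s : ℤ) (z : ℂ) (hs : 0 < s) (hz : 0 < z.im) : ‖ee s z‖ < 1 := by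
  rw [ee_norm, Real.exp_lt_one_iff]
  have : (0 : ℝ) < s := by exact_mod_cast hs
  have := Real.pi_pos
  have : 0 < 2 * π * s * z.im := by positivity
  linarith

/-- The half logarithm series. -/
def hser (l r : ℤ) (z : ℂ) : ℂ :=
  ∑' k : ℕ, ee (r % l) z ^ (k + 1) / (1 - ee l z ^ (k + 1)) / ((k : ℂ) + 1)

theorem emod_pos_of (l r : ℤ) (hl : 0 < l) (hr : ¬ l ∣ r) : 0 < r % l := by
  have h1 := Int.emod_nonneg r hl.ne'
  have h2 : r % l ≠ 0 := fun h => hr (Int.dvd_of_emod_eq_zero h)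
  omega

theorem half_prod (l r : ℤ) (hl : 0 < l) (hr : ¬ l ∣ r) (z : ℂ) (hz : 0 < z.im) :
    (∏' n : {n : ℤ // 0 < n ∧ n ≡ r [ZMOD l]},
      (1 - Complex.exp (2 * (π : ℂ) * Complex.I * ((n : ℤ) : ℂ) * z))⁻¹) =
    Complex.exp (hser l r z) := by
  rw [hser, ← prod_exp _ _ (ee_norm_lt _ z (emod_pos_of l r hl hr) hz) (ee_norm_lt _ z hl hz),
    ← (clsEquiv l r hl hr).tprod_eq]
  refine tprod_congr fun j => ?_
  rw [ee, ee, ← Complex.exp_nat_mul, ← Complex.exp_add]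
  congr 3
  simp only [clsEquiv, Equiv.coe_fn_mk]
  push_cast
  ring

theorem norm_rl (l r : ℤ) (hl : 0 < l) (hr : ¬ l ∣ r) (z : ℍ) :
    ‖rl l r z‖ = Real.exp (π * l * bern ((r : ℝ) / l) * z.im +
      ((hser l r z).re + (hser l (-r) z).re)) := by
  rw [rl, half_prod l r hl hr z z.im_pos,
    half_prod l (-r) hl (by simpa using hr) z z.im_pos, norm_mul, norm_mul,
    Complex.norm_exp, Complex.norm_exp, Complex.norm_exp, ← Real.exp_add, ← Real.exp_add]
  congr 1
  simp
  ring

theorem bern_neg (x : ℝ) : bern (-x) = bern x := by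
  unfold bern
  by_cases h : Int.fract x = 0
  · have h' : Int.fract (-x) = 0 := Int.fract_neg_eq_zero.mpr h
    rw [h, h']
  · rw [Int.fract_neg h]; ring

theorem bern_sum (x : ℝ) :
    HasSum (fun k : ℕ => 1 / ((k : ℝ) + 1) ^ 2 * Real.cos (2 * π * ((k : ℝ) + 1) * x))
      (π ^ 2 * bern x) := by
  have h := hasSum_one_div_nat_pow_mul_cos (k := 1) one_ne_zero (x := Int.fract x)
    ⟨Int.fract_nonneg x, (Int.fract_lt_one x).le⟩
  have h2 := (hasSum_nat_add_iff' 1).mpr h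
  simp only [Finset.range_one, Finset.sum_singleton] at h2
  convert! h2 using 1
  · ext k
    push_cast
    congr 1
    have : 2 * π * ((k : ℝ) + 1) * x =
        2 * π * ((k : ℝ) + 1) * Int.fract x + ((k + 1) * ⌊x⌋ : ℤ) * (2 * π) := by
      push_cast
      nth_rewrite 1 [← Int.floor_add_fract x]
      ring
    rw [this, Real.cos_add_int_mul_two_pi]
  · have := bernoulliFun_two (Int.fract x)
    rw [bernoulliFun] at this
    rw [mul_one, this]
    simp [bern]
    left
    ring

/-- The displacement from the cusp. -/
def tau (t d : ℤ) (y : ℝ) : ℂ := -1 / ((t : ℂ) * ((t : ℂ) * (Complex.I * (y : ℂ)) + (d : ℂ)))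

theorem tau_den_ne (t d : ℤ) (ht : 0 < t) (y : ℝ) (hy : 0 < y) :
    (t : ℂ) * (Complex.I * (y : ℂ)) + (d : ℂ) ≠ 0 := by
  intro h
  have := congrArg Complex.im h
  simp at this
  rcases this with h | h
  · omega
  · linarith

theorem tau_ne (t d : ℤ) (ht : 0 < t) (y : ℝ) (hy : 0 < y) : tau t d y ≠ 0 := by
  have ht' : (t : ℂ) ≠ 0 := by exact_mod_cast ht.ne'
  unfold tau
  exact div_ne_zero (by simp) (mul_ne_zero ht' (tau_den_ne t d ht y hy))

theorem tau_im (t d : ℤ) (ht : 0 < t) (y : ℝ) (hy : 0 < y) :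
    (tau t d y).im = y / ((t : ℝ) ^ 2 * y ^ 2 + (d : ℝ) ^ 2) := by
  have ht' : (0 : ℝ) < t := by exact_mod_cast ht
  have h : tau t d y = -1 / (((t * d : ℝ) : ℂ) + ((t ^ 2 * y : ℝ) : ℂ) * Complex.I) := by
    unfold tau
    congr 1
    push_cast
    ring
  have hgen : ∀ α β : ℝ, (-1 / ((α : ℂ) + (β : ℂ) * Complex.I)).im = β / (α * α + β * β) := by
    intro α β
    rw [Complex.div_im]
    simp [Complex.normSq_apply]
    ring
  rw [h, hgen]
  have : (t : ℝ) * d * (t * d) + t ^ 2 * y * (t ^ 2 * y) = t ^ 2 * (t ^ 2 * y ^ 2 + d ^ 2) := by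
    ring
  rw [this]
  have : 0 < (t : ℝ) ^ 2 * y ^ 2 + d ^ 2 := by positivity
  field_simp

theorem tau_mul_tendsto (t d : ℤ) (ht : 0 < t) :
    Tendsto (fun y : ℝ => (y : ℂ) * tau t d y) atTop (𝓝 (Complex.I / (t : ℂ) ^ 2)) := by
  have ht' : (t : ℂ) ≠ 0 := by exact_mod_cast ht.ne'
  have h0 : Tendsto (fun y : ℝ => ((y⁻¹ : ℝ) : ℂ)) atTop (𝓝 0) := by
    have := (Complex.continuous_ofReal.tendsto 0).comp (tendsto_inv_atTop_zero (𝕜 := ℝ))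
    rw [Complex.ofReal_zero] at this
    exact this
  have h1 : Tendsto (fun y : ℝ => -1 / ((t : ℂ) * ((t : ℂ) * Complex.I + (d : ℂ) * ((y⁻¹ : ℝ) : ℂ))))
      atTop (𝓝 (-1 / ((t : ℂ) * ((t : ℂ) * Complex.I + (d : ℂ) * 0)))) := by
    refine Tendsto.div tendsto_const_nhds ?_ (by simp [ht'])
    exact ((h0.const_mul _).const_add _).const_mul _
  have h2 : -1 / ((t : ℂ) * ((t : ℂ) * Complex.I + (d : ℂ) * 0)) = Complex.I / (t : ℂ) ^ 2 := by
    have := Complex.I_ne_zero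
    field_simp
    simp only [mul_zero, add_zero]
    linear_combination (-(t : ℂ)) * Complex.I_mul_I
  rw [h2] at h1
  refine h1.congr' ?_
  filter_upwards [eventually_gt_atTop 0] with y hy
  have hy' : (y : ℂ) ≠ 0 := by exact_mod_cast hy.ne'
  have h3 := tau_den_ne t d ht y hy
  have h4 : (t : ℂ) * Complex.I + (d : ℂ) * ((y⁻¹ : ℝ) : ℂ) =
      ((t : ℂ) * (Complex.I * (y : ℂ)) + (d : ℂ)) / y := by
    push_cast
    field_simp
  rw [h4, tau]
  field_simp

theorem tau_tendsto (t d : ℤ) (ht : 0 < t) :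
    Tendsto (fun y : ℝ => tau t d y) atTop (𝓝 0) := by
  have h0 : Tendsto (fun y : ℝ => ((y⁻¹ : ℝ) : ℂ)) atTop (𝓝 0) := by
    have := (Complex.continuous_ofReal.tendsto 0).comp (tendsto_inv_atTop_zero (𝕜 := ℝ))
    rw [Complex.ofReal_zero] at this
    exact this
  have := h0.mul (tau_mul_tendsto t d ht)
  rw [zero_mul] at this
  refine this.congr' ?_
  filter_upwards [eventually_gt_atTop 0] with y hy
  have hy' : (y : ℂ) ≠ 0 := by exact_mod_cast hy.ne'
  push_cast
  field_simp

theorem ee_pow (s : ℤ) (z : ℂ) (k : ℕ) :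
    ee s z ^ k = Complex.exp (2 * (π : ℂ) * Complex.I * (s : ℂ) * k * z) := by
  rw [ee, ← Complex.exp_nat_mul]
  congr 1
  ring

theorem den_tendsto (l a t d : ℤ) (ht : 0 < t) (htl : t ∣ l) (k : ℕ) :
    Tendsto (fun y : ℝ => (y : ℂ) * (1 - ee l ((a : ℂ) / t + tau t d y) ^ k)) atTop
      (𝓝 (2 * π * l * k / (t : ℂ) ^ 2)) := by
  have ht' : (t : ℂ) ≠ 0 := by exact_mod_cast ht.ne'
  obtain ⟨m, rfl⟩ := htl
  set c : ℂ := 2 * (π : ℂ) * Complex.I * ((t * m : ℤ) : ℂ) * k with hc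
  have hee : ∀ y, ee (t * m) ((a : ℂ) / t + tau t d y) ^ k = Complex.exp (c * tau t d y) := by
    intro y
    rw [ee_pow, mul_add, Complex.exp_add]
    have : 2 * (π : ℂ) * Complex.I * ((t * m : ℤ) : ℂ) * k * ((a : ℂ) / t) =
        ((m * k * a : ℤ) : ℂ) * (2 * π * Complex.I) := by
      push_cast
      field_simp
    rw [this, Complex.exp_int_mul_two_pi_mul_I, one_mul]
  have hd : HasDerivAt (fun w : ℂ => Complex.exp (c * w)) c 0 := by
    have := ((hasDerivAt_id (0 : ℂ)).const_mul c).cexp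
    simpa using this
  have hs := hasDerivAt_iff_tendsto_slope.mp hd
  have htn : Tendsto (fun y : ℝ => tau t d y) atTop (𝓝[≠] 0) := by
    rw [tendsto_nhdsWithin_iff]
    refine ⟨tau_tendsto t d ht, ?_⟩
    filter_upwards [eventually_gt_atTop 0] with y hy
    exact tau_ne t d ht y hy
  have h1 := ((hs.comp htn).mul (tau_mul_tendsto t d ht)).neg
  have h2 : -(c * (Complex.I / (t : ℂ) ^ 2)) = 2 * π * ((t * m : ℤ) : ℂ) * k / (t : ℂ) ^ 2 := by
    rw [hc]
    linear_combination (-(2 * (π : ℂ) * ((t * m : ℤ) : ℂ) * k) / (t : ℂ) ^ 2) * Complex.I_sq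
  rw [h2] at h1
  refine h1.congr' ?_
  filter_upwards [eventually_gt_atTop 0] with y hy
  have h3 := tau_ne t d ht y hy
  rw [hee]
  simp only [Function.comp, slope_def_field, mul_zero, Complex.exp_zero, sub_zero]
  field_simp
  ring

theorem term_bound (l s a t d : ℤ) (hl : 0 < l) (hs : 0 < s) (ht : 0 < t) (y : ℝ) (hy : 1 ≤ y)
    (k : ℕ) :
    ‖(y : ℂ)⁻¹ * (ee s ((a : ℂ) / t + tau t d y) ^ (k + 1) /
      (1 - ee l ((a : ℂ) / t + tau t d y) ^ (k + 1)) / ((k : ℂ) + 1))‖ ≤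
      ((t : ℝ) ^ 2 + (d : ℝ) ^ 2) * (1 / ((k : ℝ) + 1) ^ 2) := by
  have hy0 : 0 < y := by linarith
  have ht' : (0 : ℝ) < t := by exact_mod_cast ht
  set z := (a : ℂ) / t + tau t d y with hz
  have him : z.im = y / ((t : ℝ) ^ 2 * y ^ 2 + (d : ℝ) ^ 2) := by
    rw [hz, Complex.add_im, tau_im t d ht y hy0]
    have : ((a : ℂ) / t).im = 0 := by
      have : (a : ℂ) / t = ((a / t : ℝ) : ℂ) := by push_cast; rfl
      rw [this, Complex.ofReal_im]
    rw [this, zero_add]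
  have hpos : 0 < (t : ℝ) ^ 2 * y ^ 2 + (d : ℝ) ^ 2 := by positivity
  have hzi : 0 < z.im := by rw [him]; positivity
  have hpi := Real.pi_gt_three
  set X := 2 * π * ((k : ℝ) + 1) * z.im with hX
  have hXpos : 0 < X := by positivity
  have hle : ∀ s : ℤ, 0 < s → ‖ee s z ^ (k + 1)‖ ≤ Real.exp (-X) := by
    intro s hs
    rw [norm_pow, ee_norm, ← Real.exp_nat_mul]
    apply Real.exp_le_exp.mpr
    have hs1 : (1 : ℝ) ≤ s := by exact_mod_cast hs
    push_cast
    have : 0 ≤ X * (s - 1) := mul_nonneg hXpos.le (by linarith)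
    rw [hX] at this ⊢
    nlinarith
  have hk : ‖(k : ℂ) + 1‖ = (k : ℝ) + 1 := by
    exact_mod_cast Complex.norm_natCast (k + 1)
  have hexp1 : Real.exp (-X) < 1 := Real.exp_lt_one_iff.mpr (by linarith)
  have hden : 1 - Real.exp (-X) ≤ ‖1 - ee l z ^ (k + 1)‖ := by
    have h1 := norm_sub_norm_le (1 : ℂ) (ee l z ^ (k + 1))
    have h2 := hle l hl
    rw [norm_one] at h1
    linarith
  have hfrac : Real.exp (-X) / (1 - Real.exp (-X)) ≤ 1 / X := by
    rw [div_le_div_iff₀ (by linarith) hXpos]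
    have h1 := Real.add_one_le_exp X
    have h2 : Real.exp (-X) * Real.exp X = 1 := by rw [← Real.exp_add]; simp
    nlinarith [Real.exp_pos (-X)]
  have hmain : ‖ee s z ^ (k + 1) / (1 - ee l z ^ (k + 1))‖ ≤ 1 / X := by
    rw [norm_div]
    refine le_trans ?_ hfrac
    have := hle s hs
    have : 0 < 1 - Real.exp (-X) := by linarith
    gcongr
  rw [norm_mul, norm_div _ ((k : ℂ) + 1), hk, norm_inv, Complex.norm_real,
    Real.norm_of_nonneg hy0.le]
  have hXy : y⁻¹ * (1 / X) ≤ ((t : ℝ) ^ 2 + (d : ℝ) ^ 2) / ((k : ℝ) + 1) := by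
    have : y⁻¹ * (1 / X) =
        ((t : ℝ) ^ 2 + (d : ℝ) ^ 2 / y ^ 2) / (2 * π) / ((k : ℝ) + 1) := by
      rw [hX, him]
      field_simp
    rw [this]
    gcongr
    have h1 : (d : ℝ) ^ 2 / y ^ 2 ≤ (d : ℝ) ^ 2 :=
      div_le_self (by positivity) (by nlinarith)
    refine (div_le_self (by positivity) (by linarith)).trans ?_
    linarith
  calc y⁻¹ * (‖ee s z ^ (k + 1) / (1 - ee l z ^ (k + 1))‖ / ((k : ℝ) + 1))
      ≤ y⁻¹ * ((1 / X) / ((k : ℝ) + 1)) := by gcongr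
    _ = (y⁻¹ * (1 / X)) / ((k : ℝ) + 1) := by ring
    _ ≤ (((t : ℝ) ^ 2 + (d : ℝ) ^ 2) / ((k : ℝ) + 1)) / ((k : ℝ) + 1) := by gcongr
    _ = _ := by field_simp

theorem hser_tendsto (l r a t d : ℤ) (hl : 0 < l) (hr : ¬ l ∣ r) (ht : 0 < t) (htl : t ∣ l) :
    Tendsto (fun y : ℝ => (hser l r ((a : ℂ) / t + tau t d y)).re / y) atTop
      (𝓝 (π * t ^ 2 / (2 * l) * bern ((r : ℝ) * a / t))) := by
  have ht' : (t : ℂ) ≠ 0 := by exact_mod_cast ht.ne'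
  have hl' : (l : ℂ) ≠ 0 := by exact_mod_cast hl.ne'
  have hpi : (π : ℂ) ≠ 0 := by exact_mod_cast Real.pi_ne_zero
  have hbsum : Summable (fun k : ℕ => ((t : ℝ) ^ 2 + (d : ℝ) ^ 2) * (1 / ((k : ℝ) + 1) ^ 2)) := by
    apply Summable.mul_left
    have := (summable_nat_add_iff 1).mpr (Real.summable_one_div_nat_pow.mpr one_lt_two)
    simpa using this
  have hT := tendsto_tsum_of_dominated_convergence (𝓕 := atTop)
    (f := fun (y : ℝ) (k : ℕ) => (y : ℂ)⁻¹ * (ee (r % l) ((a : ℂ) / t + tau t d y) ^ (k + 1) /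
      (1 - ee l ((a : ℂ) / t + tau t d y) ^ (k + 1)) / ((k : ℂ) + 1)))
    (g := fun k : ℕ => ee (r % l) ((a : ℂ) / t) ^ (k + 1) /
      (2 * π * l * ((k + 1 : ℕ) : ℂ) / (t : ℂ) ^ 2) / ((k : ℂ) + 1)) hbsum ?_ ?_
  · have hre := (Complex.continuous_re.tendsto _).comp hT
    have hsb := (bern_sum ((r : ℝ) * a / t)).mul_left ((t : ℝ) ^ 2 / (2 * π * l))
    have hlim : (∑' k : ℕ, ee (r % l) ((a : ℂ) / t) ^ (k + 1) /
      (2 * π * l * ((k + 1 : ℕ) : ℂ) / (t : ℂ) ^ 2) / ((k : ℂ) + 1)).re =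
        π * t ^ 2 / (2 * l) * bern ((r : ℝ) * a / t) := by
      have hsm : Summable (fun k : ℕ => ee (r % l) ((a : ℂ) / t) ^ (k + 1) /
          (2 * π * l * ((k + 1 : ℕ) : ℂ) / (t : ℂ) ^ 2) / ((k : ℂ) + 1)) := by
        have h1 := (summable_nat_add_iff 1).mpr (Real.summable_one_div_nat_pow.mpr one_lt_two)
        refine Summable.of_norm_bounded (h1.mul_left ((t : ℝ) ^ 2 / (2 * π * l))) fun k => ?_
        have hk : ‖(k : ℂ) + 1‖ = (k : ℝ) + 1 := by
          exact_mod_cast Complex.norm_natCast (k + 1)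
        have h0 : ((a : ℂ) / t).im = 0 := by
          have : (a : ℂ) / t = ((a / t : ℝ) : ℂ) := by push_cast; rfl
          rw [this, Complex.ofReal_im]
        have hl0 : (0 : ℝ) < l := by exact_mod_cast hl
        rw [norm_div, norm_div, norm_pow, ee_norm, h0, hk]
        simp [hk, abs_of_pos hl0, abs_of_pos Real.pi_pos]
        apply le_of_eq
        have := Real.pi_pos
        field_simp
      rw [Complex.re_tsum hsm]
      have : π * t ^ 2 / (2 * l) * bern ((r : ℝ) * a / t) =
          (t : ℝ) ^ 2 / (2 * π * l) * (π ^ 2 * bern ((r : ℝ) * a / t)) := by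
        have := Real.pi_pos
        field_simp
      rw [this, ← hsb.tsum_eq]
      refine tsum_congr fun k => ?_
      obtain ⟨m, rfl⟩ := htl
      have he : ee (r % (t * m)) ((a : ℂ) / t) ^ (k + 1) =
          Complex.exp ((2 * π * ((k : ℝ) + 1) * ((r : ℝ) * a / t) : ℝ) * Complex.I) := by
        rw [ee_pow]
        have h1 : r % (t * m) = r - t * m * (r / (t * m)) := by
          have := Int.emod_add_mul_ediv r (t * m)
          linarith
        rw [h1, Complex.exp_eq_exp_iff_exists_int]
        refine ⟨-(m * (r / (t * m)) * (k + 1) * a), ?_⟩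
        set w := r / (t * m)
        push_cast
        field_simp
        ring
      have h2 : ee (r % (t * m)) ((a : ℂ) / t) ^ (k + 1) /
          (2 * π * ((t * m : ℤ) : ℂ) * ((k + 1 : ℕ) : ℂ) / (t : ℂ) ^ 2) / ((k : ℂ) + 1) =
          (((t : ℝ) ^ 2 / (2 * π * ((t * m : ℤ) : ℝ)) * (1 / ((k : ℝ) + 1) ^ 2) : ℝ) : ℂ) *
          Complex.exp ((2 * π * ((k : ℝ) + 1) * ((r : ℝ) * a / t) : ℝ) * Complex.I) := by
        rw [he]
        have hk : (k : ℂ) + 1 ≠ 0 := by exact_mod_cast Nat.succ_ne_zero k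
        push_cast
        push_cast at hl'
        field_simp
      rw [h2, Complex.re_ofReal_mul, Complex.exp_ofReal_mul_I_re]
      ring
    rw [← hlim]
    refine hre.congr fun y => ?_
    simp only [Function.comp]
    rw [tsum_mul_left, ← hser, ← Complex.ofReal_inv, Complex.re_ofReal_mul]
    ring
  · intro k
    have h1 := den_tendsto l a t d ht htl (k + 1)
    have h2 : Tendsto (fun y : ℝ => ee (r % l) ((a : ℂ) / t + tau t d y) ^ (k + 1)) atTop
        (𝓝 (ee (r % l) ((a : ℂ) / t) ^ (k + 1))) := by
      have hc : Continuous (fun w : ℂ => ee (r % l) ((a : ℂ) / t + w) ^ (k + 1)) := by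
        unfold ee
        fun_prop
      have := (hc.tendsto 0).comp (tau_tendsto t d ht)
      rw [add_zero] at this
      exact this
    have hne : 2 * π * l * ((k + 1 : ℕ) : ℂ) / (t : ℂ) ^ 2 ≠ 0 := by
      have hk : ((k + 1 : ℕ) : ℂ) ≠ 0 := by exact_mod_cast Nat.succ_ne_zero k
      exact div_ne_zero (mul_ne_zero (mul_ne_zero (mul_ne_zero two_ne_zero hpi) hl') hk)
        (pow_ne_zero 2 ht')
    refine ((h2.div h1 hne).div_const ((k : ℂ) + 1)).congr fun y => ?_
    simp only [Pi.div_apply]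
    rw [div_mul_eq_div_div_swap]
    ring
  · filter_upwards [eventually_ge_atTop 1] with y hy k
    exact term_bound l _ a t d hl (emod_pos_of l r hl hr) ht y hy k

/-- The point `i·max(y,1)` of the upper half plane. -/
def pt (y : ℝ) : ℍ := ⟨Complex.I * ((max y 1 : ℝ) : ℂ), by simp⟩

theorem smul_pt (A : SL(2, ℤ)) (a t d : ℤ) (ha : A 0 0 = a) (htA : A 1 0 = t) (hd : A 1 1 = d)
    (ht : 0 < t) (y : ℝ) (hy : 1 ≤ y) :
    ((A • pt y : ℍ) : ℂ) = (a : ℂ) / t + tau t d y := by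
  have ht' : (t : ℂ) ≠ 0 := by exact_mod_cast ht.ne'
  have hdet := A.det_coe
  rw [Matrix.det_fin_two, ha, htA, hd] at hdet
  have hdet' : (a : ℂ) * d - (A 0 1 : ℤ) * t = 1 := by exact_mod_cast hdet
  have hne := tau_den_ne t d ht y (by linarith)
  rw [UpperHalfPlane.coe_specialLinearGroup_apply, ha, htA, hd, tau]
  have hp : ((pt y : ℍ) : ℂ) = Complex.I * (y : ℂ) := by
    simp only [pt, max_eq_left hy]
  rw [hp]
  simp only [algebraMap_int_eq, eq_intCast, Complex.ofReal_intCast]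
  rw [div_eq_iff hne, add_mul, neg_div, neg_mul, one_div, mul_inv,
    inv_mul_cancel_right₀ hne]
  field_simp
  linear_combination (-1 : ℂ) * hdet'

/-- `g` has exponential growth rate exactly `α` at `+∞`. -/
def Growth (g : ℝ → ℂ) (α : ℝ) : Prop :=
  ∃ G : ℝ → ℝ, (∀ y, ‖g y‖ = Real.exp (G y)) ∧ Tendsto (fun y => G y / y) atTop (𝓝 α)

theorem growth_rl (A : SL(2, ℤ)) (l r a t : ℤ) (ha : A 0 0 = a) (htA : A 1 0 = t)
    (hl : 0 < l) (hr : ¬ l ∣ r) (ht : 0 < t) (htl : t ∣ l) :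
    Growth (fun y => rl l r (A • pt y)) (π * t ^ 2 / l * bern ((r : ℝ) * a / t)) := by
  refine ⟨_, fun y => norm_rl l r hl hr _, ?_⟩
  set d := A 1 1 with hd
  have hl' : (0 : ℝ) < l := by exact_mod_cast hl
  have h1 := hser_tendsto l r a t d hl hr ht htl
  have h2 := hser_tendsto l (-r) a t d hl (by simpa using hr) ht htl
  have h3 : Tendsto (fun y : ℝ => π * l * bern ((r : ℝ) / l) * ((tau t d y).im * y⁻¹)) atTop
      (𝓝 (π * l * bern ((r : ℝ) / l) * (0 * 0))) := by
    refine (Tendsto.mul ?_ tendsto_inv_atTop_zero).const_mul _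
    have := (Complex.continuous_im.tendsto _).comp (tau_tendsto t d ht)
    rw [Complex.zero_im] at this
    exact this
  have h4 := h3.add (h1.add h2)
  have e : π * l * bern ((r : ℝ) / l) * (0 * 0) + (π * t ^ 2 / (2 * l) * bern ((r : ℝ) * a / t) +
      π * t ^ 2 / (2 * l) * bern (((-r : ℤ) : ℝ) * a / t)) =
      π * t ^ 2 / l * bern ((r : ℝ) * a / t) := by
    have : ((-r : ℤ) : ℝ) * a / t = -((r : ℝ) * a / t) := by push_cast; ring
    rw [this, bern_neg]
    field_simp
    ring
  rw [e] at h4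
  refine h4.congr' ?_
  filter_upwards [eventually_ge_atTop 1] with y hy
  have hz := smul_pt A a t d ha htA hd.symm ht y hy
  have him : (A • pt y : ℍ).im = (tau t d y).im := by
    rw [← UpperHalfPlane.coe_im, hz, Complex.add_im]
    have : (a : ℂ) / t = ((a / t : ℝ) : ℂ) := by push_cast; rfl
    rw [this, Complex.ofReal_im, zero_add]
  rw [hz, him]
  ring

theorem growth_list (A : SL(2, ℤ)) (l : ℕ) (a t : ℤ) (ha : A 0 0 = a) (htA : A 1 0 = t)
    (hl : 0 < l) (ht : 0 < t) (htl : t ∣ l) (L : List ℤ) (hL : ∀ r ∈ L, ¬ (l : ℤ) ∣ r) :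
    Growth (fun y => listProdRl l L (A • pt y))
      (π * t ^ 2 / l * (L.map fun r : ℤ => bern ((r : ℝ) * (a : ℝ) / (t : ℝ))).sum) := by
  induction L with
  | nil => exact ⟨fun _ => 0, by simp [listProdRl], by simp⟩
  | cons r L ih =>
    obtain ⟨G, hG, hG'⟩ := ih fun r hr => hL r (List.mem_cons_of_mem _ hr)
    obtain ⟨H, hH, hH'⟩ := growth_rl A l r a t ha htA (by exact_mod_cast hl)
      (hL r List.mem_cons_self) ht htl
    refine ⟨fun y => H y + G y, fun y => ?_, ?_⟩
    · have : listProdRl l (r :: L) (A • pt y) = rl l r (A • pt y) * listProdRl l L (A • pt y) := by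
        simp [listProdRl]
      have e1 := hG y
      have e2 := hH y
      simp only at e1 e2 ⊢
      rw [this, norm_mul, Real.exp_add, e1, e2]
    · have := hH'.add hG'
      rw [List.map_cons, List.sum_cons, mul_add]
      refine Tendsto.congr (fun y => ?_) (by simpa using this)
      ring

theorem compare (l : ℕ) (T : Finset (List ℤ))
    (hmod : IsModularSet ((fun L => listProdRl l L) '' (T : Set (List ℤ))))
    (A A' : SL(2, ℤ)) (α α' : List ℤ → ℝ)
    (h : ∀ L ∈ T, Growth (fun y => listProdRl l L (A • pt y)) (α L))
    (h' : ∀ L ∈ T, Growth (fun y => listProdRl l L (A' • pt y)) (α' L))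
    (L : List ℤ) (hL : L ∈ T) : ∃ L' ∈ T, α L ≤ α' L' := by
  by_contra! hcon
  obtain ⟨M, hM, hmax⟩ := T.exists_max_image α' ⟨L, hL⟩
  obtain ⟨β, hβ1, hβ2⟩ := exists_between (hcon M hM)
  have hspan : ∀ f ∈ Submodule.span ℂ ((fun L => listProdRl l L) '' (T : Set (List ℤ))),
      Tendsto (fun y : ℝ => f (A' • pt y) * (Real.exp (-(β * y)) : ℂ)) atTop (𝓝 0) := by
    intro f hf
    induction hf using Submodule.span_induction with
    | mem f hf =>
      obtain ⟨K, hK, rfl⟩ := hf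
      obtain ⟨G, hG, hG'⟩ := h' K hK
      rw [tendsto_zero_iff_norm_tendsto_zero]
      have hb : Tendsto (fun y : ℝ => (G y / y - β) * y) atTop atBot := by
        refine Tendsto.neg_mul_atTop (C := α' K - β) ?_ (hG'.sub_const β) tendsto_id
        linarith [hmax K hK]
      refine (Real.tendsto_exp_atBot.comp hb).congr' ?_
      filter_upwards [eventually_gt_atTop 0] with y hy
      simp only [Function.comp]
      rw [norm_mul, hG, Complex.norm_real, Real.norm_of_nonneg (Real.exp_pos _).le,
        ← Real.exp_add]
      congr 1
      field_simp
      ring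
    | zero => simp
    | add f g _ _ hf hg =>
      have := hf.add hg
      rw [add_zero] at this
      refine this.congr fun y => ?_
      simp only [Pi.add_apply]
      ring
    | smul c f _ hf =>
      have := hf.const_mul c
      rw [mul_zero] at this
      refine this.congr fun y => ?_
      simp only [Pi.smul_apply, smul_eq_mul]
      ring
  have hmem := hmod.2.2 (A * A'⁻¹) (listProdRl l L) (Submodule.subset_span ⟨L, hL, rfl⟩)
  have h0 := hspan _ hmem
  rw [tendsto_zero_iff_norm_tendsto_zero] at h0
  obtain ⟨G, hG, hG'⟩ := h L hL
  have hb : Tendsto (fun y : ℝ => (G y / y - β) * y) atTop atTop := by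
    refine Tendsto.pos_mul_atTop (C := α L - β) (by linarith) (hG'.sub_const β) tendsto_id
  have h1 := Real.tendsto_exp_atTop.comp hb
  refine not_tendsto_atTop_of_tendsto_nhds h0 (h1.congr' ?_)
  filter_upwards [eventually_gt_atTop 0] with y hy
  simp only [Function.comp]
  rw [← mul_smul, inv_mul_cancel_right, norm_mul, hG, Complex.norm_real,
    Real.norm_of_nonneg (Real.exp_pos _).le, ← Real.exp_add]
  congr 1
  field_simp
  ring

theorem exists_mat (a t : ℤ) (h : Int.gcd a t = 1) : ∃ A : SL(2, ℤ), A 0 0 = a ∧ A 1 0 = t := by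
  have hb := Int.gcd_eq_gcd_ab a t
  rw [h] at hb
  refine ⟨⟨!![a, -Int.gcdB a t; t, Int.gcdA a t], ?_⟩, ?_, ?_⟩
  · rw [Matrix.det_fin_two_of]
    push_cast at hb
    linarith
  · simp
  · simp

theorem bern_int (L : List ℤ) :
    (L.map fun r : ℤ => bern ((r : ℝ) * ((0 : ℤ) : ℝ) / ((1 : ℤ) : ℝ))).sum = L.length / 6 := by
  simp [bern]
  ring

/-- If the set of products `[a₁,…,a_k]_l` attached to a set `T` of tuples of lengths `≤ n`
(containing a tuple of length `n`) is a modular set, then for every divisor `t` of `l` the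
maximum of `Σ_j B(a_j·a/t)` over tuples in `T` and integers `a` coprime to `t` equals
`n/(6t²)`. -/
theorem sl2z_invariant_units_stmt8 (n l : ℕ) (hn : 1 ≤ n) (hl : 2 ≤ l)
    (T : Finset (List ℤ)) (hT : T.Nonempty)
    (hlen : ∀ L ∈ T, L.length ≤ n ∧ ∀ r ∈ L, ¬ (l : ℤ) ∣ r)
    (hfull : ∃ L ∈ T, L.length = n)
    (hmod : IsModularSet ((fun L => listProdRl l L) '' (T : Set (List ℤ)))) :
    ∀ t : ℕ, t ∣ l →
      IsGreatest {x : ℝ | ∃ L ∈ T, ∃ a : ℤ, Int.gcd a t = 1 ∧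
          x = (L.map fun r => bern ((r : ℝ) * (a : ℝ) / (t : ℝ))).sum}
        ((n : ℝ) / (6 * (t : ℝ) ^ 2)) := by
  have conv : ∀ (L : List ℤ) (a : ℤ) (t : ℕ),
      (L.map fun r => bern ((r : ℝ) * (a : ℝ) / (t : ℝ))).sum =
      (L.map fun r : ℤ => bern ((r : ℝ) * (a : ℝ) / (t : ℝ))).sum := by
    intro L a t
    congr 1
    induction L with
    | nil => rfl
    | cons r L ih => simp_all
  intro t htl
  have hl0 : 0 < l := by omega
  have ht0 : 0 < t := Nat.pos_of_dvd_of_pos htl hl0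
  have htR : (0 : ℝ) < t := by exact_mod_cast ht0
  have hlR : (0 : ℝ) < l := by exact_mod_cast hl0
  have hpi := Real.pi_pos
  obtain ⟨A₀, hA0, hA1⟩ := exists_mat 0 1 (by simp)
  have g0 : ∀ L ∈ T, Growth (fun y => listProdRl l L (A₀ • pt y))
      (π / l * (L.length / 6)) := by
    intro L hL
    have := growth_list A₀ l 0 1 hA0 hA1 hl0 one_pos (one_dvd _) L (hlen L hL).2
    rw [bern_int] at this
    simpa using this
  have gA : ∀ (A : SL(2, ℤ)) (a : ℤ), A 0 0 = a → A 1 0 = (t : ℤ) → ∀ L ∈ T,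
      Growth (fun y => listProdRl l L (A • pt y))
        (π / l * (t ^ 2 * (L.map fun r : ℤ => bern ((r : ℝ) * (a : ℝ) / (t : ℝ))).sum)) := by
    intro A a ha ht L hL
    have := growth_list A l a t ha ht hl0 (by exact_mod_cast ht0) (by exact_mod_cast htl) L
      (hlen L hL).2
    convert this using 1
    push_cast
    ring
  have hpl : 0 < π / l := by positivity
  have upper : ∀ L ∈ T, ∀ a : ℤ, Int.gcd a t = 1 →
      (L.map fun r : ℤ => bern ((r : ℝ) * (a : ℝ) / (t : ℝ))).sum ≤ (n : ℝ) / (6 * (t : ℝ) ^ 2) := by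
    intro L hL a ha
    obtain ⟨A, h1, h2⟩ := exists_mat a t ha
    obtain ⟨L', hL', hle⟩ := compare l T hmod A A₀ _ _ (gA A a h1 h2) g0 L hL
    have h3 := le_of_mul_le_mul_left hle hpl
    have h4 : (L'.length : ℝ) ≤ n := by exact_mod_cast (hlen L' hL').1
    rw [le_div_iff₀ (by positivity)]
    linarith
  refine ⟨?_, ?_⟩
  · obtain ⟨L, hL, hLn⟩ := hfull
    obtain ⟨A, h1, h2⟩ := exists_mat 1 t (by simp)
    obtain ⟨L', hL', hle⟩ := compare l T hmod A₀ A _ _ g0 (gA A 1 h1 h2) L hL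
    have h3 := le_of_mul_le_mul_left hle hpl
    rw [hLn] at h3
    refine ⟨L', hL', 1, by simp, ?_⟩
    rw [conv]
    refine le_antisymm ?_ (upper L' hL' 1 (by simp))
    rw [div_le_iff₀ (by positivity)]
    linarith
  · rintro x ⟨L, hL, a, ha, rfl⟩
    rw [conv]
    exact upper L hL a ha
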